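/- Let k_1 ≥ 2, s ≥ k_1, and Γ = Γ_{k_1,k_1,s} = Γ_{k_1,k_1} ∪ {1 2 ⋯ s (s+1)}. Then U_{Γ,1}(y) = −y, and for all n ≥ 2, U_{Γ,n}(y) = −y·Σ_{r=1}^{k_1−1} U_{Γ,n−r}(y) − y·Σ_{p=0}^{s−k_1} [ (1 + binom(n−p−2, k_1−1))·U_{Γ,n−p−k_1}(y) + y·binom(n−p−2, k_1−1)·Σ_{a=1}^{k_1−1} U_{Γ,n−p−k_1−a}(y) ]. -/

import Mathlib

open Polynomial

/-- The reduction of a list of distinct integers: replace the i-th smallest entry by i. -/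
def redL (l : List ℕ) : List ℕ :=
  l.map (fun x => (l.countP (fun y => decide (y < x))) + 1)

/-- The number of descents of a list. -/
def desL (l : List ℕ) : ℕ :=
  (l.zip l.tail).countP (fun p => decide (p.2 < p.1))

/-- `σ` has a `Γ`-match: some consecutive factor of length at least 2 reduces to a member of `Γ`. -/
def HasMatch (Γ : Set (List ℕ)) (l : List ℕ) : Prop :=
  ∃ i j : ℕ, 1 ≤ j ∧ i + j + 1 ≤ l.length ∧ redL ((l.drop i).take (j + 1)) ∈ Γ

open scoped Classical in
/-- The set of permutations of `{1,…,n}` (in one-line notation, as lists) with no `Γ`-match. -/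
noncomputable def NMfinset (Γ : Set (List ℕ)) (n : ℕ) : Finset (List ℕ) :=
  ((List.range' 1 n).permutations.toFinset).filter (fun l => ¬ HasMatch Γ l)

/-- `NM_{Γ,n}(y) = Σ_{σ ∈ NM_n(Γ)} y^{1+des(σ)}` for `n ≥ 1`, and `NM_{Γ,0}(y) = 1`. -/
noncomputable def NMpoly (Γ : Set (List ℕ)) (n : ℕ) : Polynomial ℚ :=
  if n = 0 then 1 else ∑ l ∈ NMfinset Γ n, X ^ (1 + desL l)

/-- The family `Γ_{k₁,k₂}`. -/
def GammaK (k1 k2 : ℕ) : Set (List ℕ) :=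
  {σ : List ℕ | σ.length = k1 + k2 ∧ σ.Perm (List.range' 1 (k1 + k2)) ∧
    σ.getD 0 0 = 1 ∧ σ.getD k1 0 = 2 ∧
    (∀ i, i + 1 < k1 → σ.getD i 0 < σ.getD (i + 1) 0) ∧
    (∀ i, k1 ≤ i → i + 1 < k1 + k2 → σ.getD i 0 < σ.getD (i + 1) 0)}


/-- number of elements of `A` lying above some element of `T` -/
def cAb (A T : Finset ℕ) : ℕ := (A.filter (fun x => ∃ t ∈ T, t < x)).card

/-- complementary (red) relation between consecutive blocks -/
def Red (k : ℕ) (A B : Finset ℕ) : Prop :=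
  cAb A B = 0 ∨ (cAb A B = k - 1 ∧ k ≤ A.card ∧ k ≤ B.card)

theorem sdiff_card_lt_aux {Y T : Finset ℕ} (h : Y ⊆ T) (hn : Y.Nonempty) :
    (T \ Y).card < T.card := by
  apply Finset.card_lt_card
  rw [Finset.ssubset_iff_subset_ne]
  refine ⟨Finset.sdiff_subset, fun h' => ?_⟩
  obtain ⟨x, hx⟩ := hn
  have := h hx
  rw [← h'] at this
  simp [hx] at this

open scoped Classical in
/-- signed weight of red sequences of blocks with first block `A` and the rest partitioning `T` -/
noncomputable def Rw (k s : ℕ) (A T : Finset ℕ) : Polynomial ℚ :=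
  if A.card ≤ s then
    -X * (if T = ∅ then 1 else
      ∑ Y ∈ T.powerset, if _h : Y ⊆ T ∧ Y.Nonempty then
        (if Red k A Y then Rw k s Y (T \ Y) else 0) else 0)
  else 0
termination_by T.card
decreasing_by exact sdiff_card_lt_aux _h.1 _h.2

open scoped Classical in
/-- signed weight of red sequences on `S` -/
noncomputable def Ww (k s : ℕ) (S : Finset ℕ) : Polynomial ℚ :=
  if S = ∅ then 1 else ∑ Y ∈ S.powerset, if Y.Nonempty then Rw k s Y (S \ Y) else 0

open scoped Classical in
theorem Rw_eq (k s : ℕ) (A T : Finset ℕ) : Rw k s A T =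
  if A.card ≤ s then
    -X * (if T = ∅ then 1 else
      ∑ Y ∈ T.powerset, if Y.Nonempty ∧ Red k A Y then Rw k s Y (T \ Y) else 0)
  else 0 := by
  rw [Rw]
  congr 3
  apply Finset.sum_congr rfl
  intro Y hY
  rw [Finset.mem_powerset] at hY
  by_cases h : Y.Nonempty <;> simp [h, hY]

theorem sum_swap_aux (T : Finset ℕ) (f : Finset ℕ → Finset ℕ → Finset ℕ → Polynomial ℚ) :
    ∑ A ∈ T.powerset, ∑ Y ∈ A.powerset, f Y (A \ Y) (T \ A) =
    ∑ Y ∈ T.powerset, ∑ A ∈ (T \ Y).powerset, f Y A ((T \ Y) \ A) := by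
  rw [Finset.sum_sigma', Finset.sum_sigma']
  refine Finset.sum_bij' (fun p _ => ⟨p.2, p.1 \ p.2⟩) (fun p _ => ⟨p.1 ∪ p.2, p.1⟩) ?_ ?_ ?_ ?_ ?_
  · rintro ⟨A, Y⟩ h
    simp only [Finset.mem_sigma, Finset.mem_powerset] at h ⊢
    exact ⟨h.2.trans h.1, Finset.sdiff_subset_sdiff h.1 le_rfl⟩
  · rintro ⟨Y, A⟩ h
    simp only [Finset.mem_sigma, Finset.mem_powerset] at h ⊢
    exact ⟨Finset.union_subset h.1 (h.2.trans Finset.sdiff_subset), Finset.subset_union_left⟩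
  · rintro ⟨A, Y⟩ h
    simp only [Finset.mem_sigma, Finset.mem_powerset] at h ⊢
    simp [Finset.union_sdiff_of_subset h.2]
  · rintro ⟨Y, A⟩ h
    simp only [Finset.mem_sigma, Finset.mem_powerset] at h ⊢
    have : (Y ∪ A) \ Y = A := by
      ext x
      have := @h.2 x
      simp only [Finset.mem_sdiff, Finset.mem_union] at this ⊢
      tauto
    simp [this]
  · rintro ⟨A, Y⟩ h
    simp only [Finset.mem_sigma, Finset.mem_powerset] at h ⊢
    congr 1
    ext x
    have := @h.2 x
    simp only [Finset.mem_sdiff] at this ⊢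
    tauto

open scoped Classical in
theorem inv_aux (k s : ℕ) (N : Finset ℕ → Polynomial ℚ) (B : Finset ℕ → Finset ℕ → Polynomial ℚ)
    (hN0 : N ∅ = 1)
    (hN : ∀ S : Finset ℕ, S.Nonempty →
      N S = ∑ Y ∈ S.powerset, if Y.Nonempty then B Y (S \ Y) else 0)
    (hB : ∀ A T : Finset ℕ, A.Nonempty → Disjoint A T → B A T =
      if A.card ≤ s then
        X * (if T = ∅ then 1 else
          ∑ Y ∈ T.powerset, if Y.Nonempty ∧ ¬ Red k A Y then B Y (T \ Y) else 0)
      else 0) :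
    (∀ n : ℕ, ∀ A T : Finset ℕ, T.card = n → A.Nonempty → Disjoint A T →
      ∑ C ∈ T.powerset, Rw k s A C * N (T \ C) = - B A T) := by
  intro n
  induction n using Nat.strong_induction_on with
  | _ n ih =>
  intro A T hT hA hAT
  rw [hB A T hA hAT]
  by_cases hs : A.card ≤ s
  swap
  · rw [if_neg hs, neg_zero]
    apply Finset.sum_eq_zero
    intro C _
    rw [Rw_eq, if_neg hs, zero_mul]
  rw [if_pos hs]
  by_cases hTe : T = ∅
  · subst hTe
    rw [Finset.powerset_empty, Finset.sum_singleton, Rw_eq, if_pos hs, if_pos rfl]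
    simp [hN0]
  rw [if_neg hTe]
  have hTn : T.Nonempty := Finset.nonempty_iff_ne_empty.mpr hTe
  have h1 : ∀ C ∈ T.powerset, Rw k s A C * N (T \ C) =
      -X * ((if C = ∅ then N T else 0) + ∑ Y ∈ C.powerset,
        (if Y.Nonempty ∧ Red k A Y then Rw k s Y (C \ Y) * N (T \ C) else 0)) := by
    intro C _
    rw [Rw_eq, if_pos hs]
    by_cases hC : C = ∅
    · subst hC
      simp
    · simp only [hC, if_false, zero_add]
      rw [mul_assoc, Finset.sum_mul]
      congr 1
      apply Finset.sum_congr rfl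
      intro Y _
      split_ifs <;> simp
  rw [Finset.sum_congr rfl h1, ← Finset.mul_sum, Finset.sum_add_distrib,
    sum_swap_aux T (fun Y C D => if Y.Nonempty ∧ Red k A Y then Rw k s Y C * N D else 0)]
  have h2 : ∑ Y ∈ T.powerset, ∑ C ∈ (T \ Y).powerset,
      (if Y.Nonempty ∧ Red k A Y then Rw k s Y C * N ((T \ Y) \ C) else 0) =
      ∑ Y ∈ T.powerset, (if Y.Nonempty ∧ Red k A Y then - B Y (T \ Y) else 0) := by
    apply Finset.sum_congr rfl
    intro Y hY
    rw [Finset.mem_powerset] at hY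
    split_ifs with h
    · exact ih _ (hT ▸ sdiff_card_lt_aux hY h.1) Y (T \ Y) rfl h.1 Finset.disjoint_sdiff
    · simp
  rw [h2, Finset.sum_ite_eq' T.powerset ∅, if_pos (Finset.empty_mem_powerset T), hN T hTn,
    ← Finset.sum_add_distrib, neg_mul]
  congr 2
  apply Finset.sum_congr rfl
  intro Y _
  by_cases h3 : Y.Nonempty <;> by_cases h4 : Red k A Y <;> simp [h3, h4]

open scoped Classical in
theorem inv_main (k s : ℕ) (N : Finset ℕ → Polynomial ℚ) (B : Finset ℕ → Finset ℕ → Polynomial ℚ)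
    (hN0 : N ∅ = 1)
    (hN : ∀ S : Finset ℕ, S.Nonempty →
      N S = ∑ Y ∈ S.powerset, if Y.Nonempty then B Y (S \ Y) else 0)
    (hB : ∀ A T : Finset ℕ, A.Nonempty → Disjoint A T → B A T =
      if A.card ≤ s then
        X * (if T = ∅ then 1 else
          ∑ Y ∈ T.powerset, if Y.Nonempty ∧ ¬ Red k A Y then B Y (T \ Y) else 0)
      else 0) (S : Finset ℕ) (hS : S.Nonempty) :
      ∑ C ∈ S.powerset, Ww k s C * N (S \ C) = 0 := by
  have h1 : ∀ C ∈ S.powerset, Ww k s C * N (S \ C) =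
      ((if C = ∅ then N S else 0) + ∑ Y ∈ C.powerset,
        (if Y.Nonempty then Rw k s Y (C \ Y) * N (S \ C) else 0)) := by
    intro C _
    rw [Ww]
    by_cases hC : C = ∅
    · subst hC
      simp
    · simp only [hC, if_false, zero_add]
      rw [Finset.sum_mul]
      apply Finset.sum_congr rfl
      intro Y _
      split_ifs <;> simp
  rw [Finset.sum_congr rfl h1, Finset.sum_add_distrib,
    sum_swap_aux S (fun Y C D => if Y.Nonempty then Rw k s Y C * N D else 0)]
  have h2 : ∑ Y ∈ S.powerset, ∑ C ∈ (S \ Y).powerset,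
      (if Y.Nonempty then Rw k s Y C * N ((S \ Y) \ C) else 0) =
      ∑ Y ∈ S.powerset, (if Y.Nonempty then - B Y (S \ Y) else 0) := by
    apply Finset.sum_congr rfl
    intro Y hY
    split_ifs with h
    · exact inv_aux k s N B hN0 hN hB _ Y (S \ Y) rfl h Finset.disjoint_sdiff
    · simp
  rw [h2, Finset.sum_ite_eq' S.powerset ∅, if_pos (Finset.empty_mem_powerset S), hN S hS,
    ← Finset.sum_add_distrib]
  apply Finset.sum_eq_zero
  intro Y _
  split_ifs <;> simp

theorem cAb_eq_zero {A T : Finset ℕ} : cAb A T = 0 ↔ ∀ x ∈ A, ∀ t ∈ T, x ≤ t := by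
  unfold cAb
  rw [Finset.card_eq_zero, Finset.filter_eq_empty_iff]
  constructor
  · intro h x hx t ht
    by_contra hlt
    exact h hx ⟨t, ht, by omega⟩
  · rintro h x hx ⟨t, ht, hlt⟩
    have := h x hx t ht
    omega

theorem cAb_le (A T : Finset ℕ) : cAb A T ≤ A.card := Finset.card_filter_le _ _

theorem cAb_congr {A Y T : Finset ℕ} (hY : Y ⊆ T) (h : ∀ t ∈ T \ Y, ∃ y ∈ Y, y < t) :
    cAb A Y = cAb A T := by
  unfold cAb
  congr 1
  apply Finset.filter_congr
  intro x _
  constructor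
  · rintro ⟨t, ht, hlt⟩
    exact ⟨t, hY ht, hlt⟩
  · rintro ⟨t, ht, hlt⟩
    by_cases hty : t ∈ Y
    · exact ⟨t, hty, hlt⟩
    · obtain ⟨y, hy, hyt⟩ := h t (by simp [ht, hty])
      exact ⟨y, hy, hyt.trans hlt⟩

theorem Red_min {k : ℕ} (hk : 2 ≤ k) {A Y : Finset ℕ} (hA : A.Nonempty) (hd : Disjoint A Y)
    (h : Red k A Y) : ∃ a ∈ A, ∀ y ∈ Y, a < y := by
  have key : ∃ a ∈ A, ∀ y ∈ Y, a ≤ y := by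
    rcases h with h | ⟨h, hA', -⟩
    · obtain ⟨a, ha⟩ := hA
      exact ⟨a, ha, fun y hy => cAb_eq_zero.mp h a ha y hy⟩
    · by_contra hcon
      push Not at hcon
      have : A.filter (fun x => ∃ t ∈ Y, t < x) = A := by
        rw [Finset.filter_eq_self]
        exact hcon
      unfold cAb at h
      rw [this] at h
      omega
  obtain ⟨a, ha, h⟩ := key
  refine ⟨a, ha, fun y hy => lt_of_le_of_ne (h y hy) ?_⟩
  rintro rfl
  exact Finset.disjoint_left.mp hd ha hy

theorem Rw_min (k s : ℕ) (hk : 2 ≤ k) : ∀ n : ℕ, ∀ A T : Finset ℕ, T.card = n → A.Nonempty →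
    Disjoint A T → Rw k s A T ≠ 0 → ∀ t ∈ T, ∃ a ∈ A, a < t := by
  classical
  intro n
  induction n using Nat.strong_induction_on with
  | _ n ih =>
  intro A T hT hA hAT hne t ht
  rw [Rw_eq] at hne
  have hTe : T ≠ ∅ := by rintro rfl; simp at ht
  split_ifs at hne with h1
  · have h2 : ∑ Y ∈ T.powerset, (if Y.Nonempty ∧ Red k A Y then Rw k s Y (T \ Y) else 0) ≠ 0 :=
      right_ne_zero_of_mul hne
    obtain ⟨Y, hY, h3⟩ := Finset.exists_ne_zero_of_sum_ne_zero h2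
    rw [Finset.mem_powerset] at hY
    split_ifs at h3 with h4
    · obtain ⟨a, ha, hay⟩ := Red_min hk hA (Finset.disjoint_of_subset_right hY hAT) h4.2
      refine ⟨a, ha, ?_⟩
      by_cases hty : t ∈ Y
      · exact hay t hty
      · obtain ⟨y, hy, hyt⟩ := ih _ (hT ▸ sdiff_card_lt_aux hY h4.1) Y (T \ Y) rfl h4.1
          Finset.disjoint_sdiff h3 t (by simp [ht, hty])
        exact (hay y hy).trans hyt
    · exact absurd rfl h3
  · exact absurd rfl hne

/-- red sequences whose first block has at least `k` elements -/
noncomputable def Wk (k s : ℕ) (T : Finset ℕ) : Polynomial ℚ :=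
  ∑ Y ∈ T.powerset, if k ≤ Y.card then Rw k s Y (T \ Y) else 0

theorem Wk_empty (k s : ℕ) (hk : 2 ≤ k) : Wk k s ∅ = 0 := by
  unfold Wk
  rw [Finset.powerset_empty, Finset.sum_singleton, if_neg]
  simp; omega

theorem Rw_formula (k s : ℕ) (hk : 2 ≤ k) (A T : Finset ℕ) (hA : A.Nonempty) (hs : A.card ≤ s) :
    Rw k s A T = (if cAb A T = 0 then -X * Ww k s T else 0) +
      (if cAb A T = k - 1 then (if k ≤ A.card then -X * Wk k s T else 0) else 0) := by
  classical
  rw [Rw_eq, if_pos hs]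
  by_cases hT : T = ∅
  · subst hT
    have : cAb A ∅ = 0 := by rw [cAb_eq_zero]; simp
    rw [this, if_pos rfl, if_pos rfl, if_neg (by omega), Ww, if_pos rfl, add_zero]
  rw [if_neg hT]
  have h1 : ∀ Y ∈ T.powerset, (if Y.Nonempty ∧ Red k A Y then Rw k s Y (T \ Y) else 0) =
      (if cAb A T = 0 then (if Y.Nonempty then Rw k s Y (T \ Y) else 0) else 0) +
      (if cAb A T = k - 1 then (if k ≤ A.card then (if k ≤ Y.card then Rw k s Y (T \ Y) else 0)
        else 0) else 0) := by
    intro Y hY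
    rw [Finset.mem_powerset] at hY
    by_cases hYn : Y.Nonempty
    swap
    · rw [Finset.not_nonempty_iff_eq_empty] at hYn
      subst hYn
      have : ¬ k ≤ 0 := by omega
      simp [this]
    by_cases h0 : Rw k s Y (T \ Y) = 0
    · simp [h0]
    have hmin := Rw_min k s hk _ Y (T \ Y) rfl hYn Finset.disjoint_sdiff h0
    unfold Red
    rw [cAb_congr hY hmin]
    by_cases h2 : cAb A T = 0
    · have : ¬ (0 = k - 1) := by omega
      simp [h2, hYn, this]
    · simp only [h2, hYn, false_or, true_and, if_false, zero_add]
      by_cases h3 : cAb A T = k - 1 <;> by_cases h4 : k ≤ A.card <;> simp [h3, h4]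
  rw [Finset.sum_congr rfl h1, Finset.sum_add_distrib, mul_add]
  congr 1
  · split_ifs with h2
    · rw [Ww, if_neg hT]
    · simp
  · split_ifs with h2 h3
    · rfl
    · simp
    · simp

theorem count_aux (S : Finset ℕ) : ∀ a j : ℕ, j ≤ a → a ≤ S.card →
    (∑ Y ∈ S.powerset, if Y.card = a ∧ cAb Y (S \ Y) = j then 1 else 0) =
      (S.card - a + j - 1).choose j := by
  induction S using Finset.induction_on_min with
  | empty =>
    intro a j hj ha
    have ha0 : a = 0 := by simpa using ha
    have hj0 : j = 0 := by omega
    subst ha0; subst hj0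
    rw [Finset.powerset_empty, Finset.sum_singleton, if_pos]
    · simp
    · simp [cAb]
  | insert m S hm ih =>
    intro a j hj ha
    have hmS : m ∉ S := fun h => lt_irrefl _ (hm m h)
    rw [Finset.card_insert_of_notMem hmS] at ha ⊢
    rw [Finset.sum_powerset_insert hmS]
    have e1 : ∀ Y ∈ S.powerset,
        (if Y.card = a ∧ cAb Y (insert m S \ Y) = j then 1 else 0) =
        if Y.card = a then (if a = j then 1 else 0) else 0 := by
      intro Y hY
      rw [Finset.mem_powerset] at hY
      have : cAb Y (insert m S \ Y) = Y.card := by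
        unfold cAb
        rw [Finset.filter_eq_self.mpr]
        intro x hx
        exact ⟨m, by simpa using fun h => hmS (hY h), hm x (hY hx)⟩
      rw [this]
      by_cases h1 : Y.card = a
      · simp [h1]
      · simp [h1]
    have e2 : ∀ Y ∈ S.powerset,
        (if (insert m Y).card = a ∧ cAb (insert m Y) (insert m S \ insert m Y) = j then 1 else 0) =
        if Y.card + 1 = a ∧ cAb Y (S \ Y) = j then 1 else 0 := by
      intro Y hY
      rw [Finset.mem_powerset] at hY
      have hmY : m ∉ Y := fun h => hmS (hY h)
      have h3 : insert m S \ insert m Y = S \ Y := by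
        ext x
        simp only [Finset.mem_sdiff, Finset.mem_insert]
        constructor
        · tauto
        · rintro ⟨hx, hx'⟩
          refine ⟨Or.inr hx, ?_⟩
          rintro (rfl | h)
          · exact hmS hx
          · exact hx' h
      rw [Finset.card_insert_of_notMem hmY, h3]
      have h4 : cAb (insert m Y) (S \ Y) = cAb Y (S \ Y) := by
        unfold cAb
        rw [Finset.filter_insert, if_neg]
        rintro ⟨t, ht, hlt⟩
        have := hm t (Finset.mem_sdiff.mp ht).1
        omega
      rw [h4]
    rw [Finset.sum_congr rfl e1, Finset.sum_congr rfl e2]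
    by_cases haj : a = j
    · subst haj
      have h5 : ∀ Y ∈ S.powerset, (if Y.card + 1 = a ∧ cAb Y (S \ Y) = a then 1 else 0) = 0 := by
        intro Y _
        rw [if_neg]
        rintro ⟨h1, h2⟩
        have := cAb_le Y (S \ Y)
        omega
      rw [Finset.sum_congr rfl h5]
      simp only [if_true, Finset.sum_const_zero, add_zero]
      rw [← Finset.card_filter, ← Finset.powersetCard_eq_filter, Finset.card_powersetCard]
      rcases Nat.eq_zero_or_pos a with h | h
      · subst h; simp
      · congr 1; omega
    · simp only [haj, if_false, ite_self, Finset.sum_const_zero, zero_add]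
      obtain ⟨b, rfl⟩ : ∃ b, a = b + 1 := ⟨a - 1, by omega⟩
      have := ih b j (by omega) (by omega)
      simp only [add_left_inj]
      rw [this]
      congr 1
      omega

theorem group_aux (S : Finset ℕ) (j : ℕ) (g : ℕ → Polynomial ℚ) (hg : ∀ a < j, g a = 0) :
    (∑ Y ∈ S.powerset, if cAb Y (S \ Y) = j then g Y.card else 0) =
    ∑ a ∈ Finset.range (S.card + 1), ((S.card - a + j - 1).choose j : Polynomial ℚ) * g a := by
  have h1 : ∀ Y ∈ S.powerset, (if cAb Y (S \ Y) = j then g Y.card else 0) =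
      ∑ a ∈ Finset.range (S.card + 1),
        (((if Y.card = a ∧ cAb Y (S \ Y) = j then 1 else 0 : ℕ)) : Polynomial ℚ) * g a := by
    intro Y hY
    rw [Finset.mem_powerset] at hY
    have hc := Finset.card_le_card hY
    rw [Finset.sum_eq_single Y.card]
    · by_cases h : cAb Y (S \ Y) = j <;> simp [h]
    · intro b _ hb
      rw [if_neg (fun h => hb h.1.symm)]
      simp
    · intro h
      exact absurd (Finset.mem_range.mpr (by omega)) h
  rw [Finset.sum_congr rfl h1, Finset.sum_comm]
  apply Finset.sum_congr rfl
  intro a ha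
  rw [Finset.mem_range] at ha
  rw [← Finset.sum_mul]
  by_cases haj : a < j
  · rw [hg a haj, mul_zero, mul_zero]
  · rw [← Nat.cast_sum, count_aux S a j (by omega) (by omega)]

theorem Wk_formula (k s : ℕ) (hk : 2 ≤ k) (hs : k ≤ s) (v : ℤ → Polynomial ℚ)
    (hneg : ∀ m : ℤ, m < 0 → v m = 0) (T : Finset ℕ)
    (hT : T.Nonempty) (hv : ∀ A : Finset ℕ, A.card < T.card → Ww k s A = v A.card) :
    Wk k s T = Ww k s T + X * ∑ b ∈ Finset.Icc 1 (k - 1), v ((T.card : ℤ) - b) := by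
  classical
  have h1 : Ww k s T = Wk k s T + ∑ Y ∈ T.powerset, if cAb Y (T \ Y) = 0 then
      (if 1 ≤ Y.card ∧ Y.card < k then -X * v ((T.card : ℤ) - Y.card) else 0) else 0 := by
    rw [Ww, if_neg hT.ne_empty, Wk, ← Finset.sum_add_distrib]
    apply Finset.sum_congr rfl
    intro Y hY
    rw [Finset.mem_powerset] at hY
    by_cases hYn : Y.Nonempty
    swap
    · rw [Finset.not_nonempty_iff_eq_empty] at hYn
      subst hYn
      have : k ≠ 0 := by omega
      simp [this]
    rw [if_pos hYn]
    have hpos : 1 ≤ Y.card := hYn.card_pos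
    by_cases hYk : k ≤ Y.card
    · have : ¬ (Y.card < k) := by omega
      simp [hYk, this]
    · have h2 : Y.card < k := by omega
      rw [if_neg hYk, zero_add, if_pos (show 1 ≤ Y.card ∧ Y.card < k from ⟨hpos, h2⟩),
        Rw_formula k s hk Y _ hYn (by omega), if_neg hYk, ite_self, add_zero,
        hv _ (sdiff_card_lt_aux hY hYn), Finset.card_sdiff_of_subset hY,
        Nat.cast_sub (Finset.card_le_card hY)]
  rw [group_aux T 0 (fun a => if 1 ≤ a ∧ a < k then -X * v ((T.card : ℤ) - a) else 0)
    (fun a ha => by omega)] at h1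
  have h3 : ∑ a ∈ Finset.range (T.card + 1), ((T.card - a + 0 - 1).choose 0 : Polynomial ℚ) *
      (if 1 ≤ a ∧ a < k then -X * v ((T.card : ℤ) - a) else 0) =
      -X * ∑ b ∈ Finset.Icc 1 (k - 1), v ((T.card : ℤ) - b) := by
    rw [Finset.mul_sum]
    simp only [Nat.choose_zero_right, Nat.cast_one, one_mul]
    rw [← Finset.sum_filter]
    apply Finset.sum_subset
    · intro a ha
      simp only [Finset.mem_filter, Finset.mem_range, Finset.mem_Icc] at ha ⊢
      omega
    · intro a ha ha'
      simp only [Finset.mem_filter, Finset.mem_range, Finset.mem_Icc] at ha ha'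
      rw [hneg _ (by omega), mul_zero]
  rw [h3] at h1
  rw [h1]
  ring

theorem Ww_formula (k s : ℕ) (hk : 2 ≤ k) (hs : k ≤ s) (v : ℤ → Polynomial ℚ)
    (hneg : ∀ m : ℤ, m < 0 → v m = 0) (S : Finset ℕ)
    (hS : S.Nonempty) (hv : ∀ A : Finset ℕ, A.card < S.card → Ww k s A = v A.card) :
    Ww k s S = -X * (∑ r ∈ Finset.Icc 1 (k - 1), v ((S.card : ℤ) - r)) -
        X * ∑ p ∈ Finset.range (s - k + 1),
          ((1 + ((S.card - p - 2).choose (k - 1) : Polynomial ℚ)) * v ((S.card : ℤ) - p - k) +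
            X * ((S.card - p - 2).choose (k - 1) : Polynomial ℚ) *
              ∑ a ∈ Finset.Icc 1 (k - 1), v ((S.card : ℤ) - p - k - a)) := by
  classical
  set n := S.card with hn
  set vk : ℤ → Polynomial ℚ := fun m => if m = 0 then 0 else
    v m + X * ∑ b ∈ Finset.Icc 1 (k - 1), v (m - b) with hvk
  have h1 : Ww k s S = (∑ Y ∈ S.powerset, if cAb Y (S \ Y) = 0 then
      (if 1 ≤ Y.card ∧ Y.card ≤ s then -X * v ((n : ℤ) - Y.card) else 0) else 0) +
      ∑ Y ∈ S.powerset, if cAb Y (S \ Y) = k - 1 then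
      (if k ≤ Y.card ∧ Y.card ≤ s then -X * vk ((n : ℤ) - Y.card) else 0) else 0 := by
    rw [Ww, if_neg hS.ne_empty, ← Finset.sum_add_distrib]
    apply Finset.sum_congr rfl
    intro Y hY
    rw [Finset.mem_powerset] at hY
    by_cases hYn : Y.Nonempty
    swap
    · rw [Finset.not_nonempty_iff_eq_empty] at hYn
      subst hYn
      have : k ≠ 0 := by omega
      simp [this]
    rw [if_pos hYn]
    have hpos : 1 ≤ Y.card := hYn.card_pos
    by_cases hYs : Y.card ≤ s
    swap
    · rw [Rw_eq]; simp [hYs]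
    have hlt := sdiff_card_lt_aux hY hYn
    have hcard : ((S \ Y).card : ℤ) = (n : ℤ) - Y.card := by
      rw [Finset.card_sdiff_of_subset hY, Nat.cast_sub (Finset.card_le_card hY)]
    have hW : Wk k s (S \ Y) = vk ((n : ℤ) - Y.card) := by
      rw [hvk]
      by_cases hne : (S \ Y).Nonempty
      · rw [Wk_formula k s hk hs v hneg _ hne (fun A hA => hv A (by omega)), hv _ hlt, hcard]
        have := hne.card_pos
        simp only
        rw [if_neg (by omega)]
      · rw [Finset.not_nonempty_iff_eq_empty] at hne
        rw [hne] at hcard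
        rw [hne, Wk_empty k s hk, ← hcard]
        simp
    rw [Rw_formula k s hk Y _ hYn hYs, hv _ hlt, hW, hcard]
    simp [hpos, hYs]
  rw [group_aux S 0 (fun a => if 1 ≤ a ∧ a ≤ s then -X * v ((n : ℤ) - a) else 0)
      (fun a ha => by omega),
    group_aux S (k - 1) (fun a => if k ≤ a ∧ a ≤ s then -X * vk ((n : ℤ) - a) else 0)
      (fun a ha => if_neg (by omega)), ← hn] at h1
  have h3 : ∑ a ∈ Finset.range (n + 1), ((n - a + 0 - 1).choose 0 : Polynomial ℚ) *
      (if 1 ≤ a ∧ a ≤ s then -X * v ((n : ℤ) - a) else 0) =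
      -X * ∑ b ∈ Finset.Icc 1 s, v ((n : ℤ) - b) := by
    rw [Finset.mul_sum]
    simp only [Nat.choose_zero_right, Nat.cast_one, one_mul]
    rw [← Finset.sum_filter]
    apply Finset.sum_subset
    · intro a ha
      simp only [Finset.mem_filter, Finset.mem_range, Finset.mem_Icc] at ha ⊢
      omega
    · intro a ha ha'
      simp only [Finset.mem_filter, Finset.mem_range, Finset.mem_Icc] at ha ha'
      rw [hneg _ (by omega), mul_zero]
  have h4 : ∑ a ∈ Finset.range (n + 1), ((n - a + (k - 1) - 1).choose (k - 1) : Polynomial ℚ) *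
      (if k ≤ a ∧ a ≤ s then -X * vk ((n : ℤ) - a) else 0) =
      ∑ a ∈ Finset.Icc k s, -X * (((n - (a - k) - 2).choose (k - 1) : Polynomial ℚ) *
        (v ((n : ℤ) - a) + X * ∑ b ∈ Finset.Icc 1 (k - 1), v ((n : ℤ) - a - b))) := by
    simp only [mul_ite, mul_zero]
    rw [← Finset.sum_filter]
    have hsub : (Finset.range (n + 1)).filter (fun a => k ≤ a ∧ a ≤ s) ⊆ Finset.Icc k s := by
      intro a ha
      simp only [Finset.mem_filter, Finset.mem_range, Finset.mem_Icc] at ha ⊢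
      omega
    rw [← Finset.sum_subset hsub]
    · apply Finset.sum_congr rfl
      intro a ha
      simp only [Finset.mem_filter, Finset.mem_range] at ha
      have e : n - a + (k - 1) - 1 = n - (a - k) - 2 := by omega
      rw [e, hvk]
      by_cases hna : (n : ℤ) - a = 0
      · have e2 : n - (a - k) - 2 < k - 1 := by omega
        rw [Nat.choose_eq_zero_of_lt e2]
        simp
      · simp only [hna, if_false]
        ring
    · intro a ha ha'
      simp only [Finset.mem_filter, Finset.mem_range, Finset.mem_Icc] at ha ha'
      rw [hneg _ (by omega), Finset.sum_eq_zero]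
      · simp
      · intro b _
        exact hneg _ (by omega)
  have h5 : ∑ b ∈ Finset.Icc 1 s, v ((n : ℤ) - b) =
      ∑ b ∈ Finset.Icc 1 (k - 1), v ((n : ℤ) - b) + ∑ b ∈ Finset.Icc k s, v ((n : ℤ) - b) := by
    rw [← Finset.sum_union]
    · apply Finset.sum_congr _ (fun _ _ => rfl)
      ext a
      simp only [Finset.mem_union, Finset.mem_Icc]
      omega
    · rw [Finset.disjoint_left]
      intro a ha
      simp only [Finset.mem_Icc] at ha ⊢
      omega
  have h6 : ∀ f : ℕ → Polynomial ℚ, ∑ b ∈ Finset.Icc k s, f b =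
      ∑ p ∈ Finset.range (s - k + 1), f (p + k) := by
    intro f
    rw [← Finset.Ico_add_one_right_eq_Icc, Finset.sum_Ico_eq_sum_range,
      show s + 1 - k = s - k + 1 by omega]
    apply Finset.sum_congr rfl
    intro a _
    rw [add_comm]
  rw [h1, h3, h4, h5, h6, h6, mul_add, add_assoc, sub_eq_add_neg]
  congr 1
  rw [← neg_mul, Finset.mul_sum, Finset.mul_sum, ← Finset.sum_add_distrib]
  apply Finset.sum_congr rfl
  intro p _
  have e1 : ((n : ℤ) - ((p + k : ℕ) : ℤ)) = (n : ℤ) - p - k := by push_cast; ring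
  rw [e1, Nat.add_sub_cancel]
  ring

/-- there is a descent between (sorted) `u` and `v`, or `v` is empty -/
def Jn (u v : List ℕ) : Prop := ∀ b q, v = b :: q → ∃ a ∈ u, b < a

theorem Jn_suffix {p c v : List ℕ} (hs : (p ++ c).Pairwise (· < ·)) (hc : c ≠ [])
    (h : Jn (p ++ c) v) : Jn c v := by
  intro b q hv
  obtain ⟨a, ha, hab⟩ := h b q hv
  rw [List.mem_append] at ha
  rcases ha with ha | ha
  · obtain ⟨d, hd⟩ := List.exists_mem_of_ne_nil c hc
    exact ⟨d, hd, hab.trans ((List.pairwise_append.mp hs).2.2 a ha d hd)⟩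
  · exact ⟨a, ha, hab⟩

theorem Jn_unique_aux {u w l l' : List ℕ} (hs : (u ++ w).Pairwise (· < ·))
    (hl : l = w ++ l') (h : Jn u l) : w = [] := by
  rcases w with _ | ⟨c, w⟩
  · rfl
  · obtain ⟨a, ha, hab⟩ := h c (w ++ l') (by simp [hl])
    have := (List.pairwise_append.mp hs).2.2 a ha c (by simp)
    omega

theorem Jn_unique {u u' l l' : List ℕ} (hu : u.Pairwise (· < ·)) (hu' : u'.Pairwise (· < ·))
    (hl : Jn u l) (hl' : Jn u' l') (h : u ++ l = u' ++ l') : u = u' ∧ l = l' := by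
  rcases List.append_eq_append_iff.mp h with ⟨w, h1, h2⟩ | ⟨w, h1, h2⟩
  · subst h1
    have := Jn_unique_aux hu' h2 hl
    subst this
    simp_all
  · subst h1
    have := Jn_unique_aux hu h2 hl'
    subst this
    simp_all

theorem desL_cons_cons (a b : ℕ) (l : List ℕ) :
    desL (a :: b :: l) = desL (b :: l) + (if b < a then 1 else 0) := by
  simp [desL, List.countP_cons]

theorem desL_sorted : ∀ (x : List ℕ), x.Pairwise (· < ·) → desL x = 0
  | [], _ => by simp [desL]
  | [a], _ => by simp [desL]
  | a :: b :: l, h => by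
    rw [desL_cons_cons, desL_sorted (b :: l) (List.Pairwise.of_cons h), if_neg]
    have := (List.pairwise_cons.mp h).1 b (by simp)
    omega

theorem desL_append : ∀ (x v : List ℕ), x.Pairwise (· < ·) → x ≠ [] → v ≠ [] → Jn x v →
    desL (x ++ v) = desL v + 1
  | [], _, _, h, _, _ => absurd rfl h
  | [a], [], _, _, h, _ => absurd rfl h
  | [a], b :: v, _, _, _, hJ => by
    obtain ⟨a', ha', hlt⟩ := hJ b v rfl
    have : a' = a := by simpa using ha'
    subst this
    simp only [List.cons_append, List.nil_append]
    rw [desL_cons_cons, if_pos hlt]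
  | a :: a' :: x, v, hs, _, hv, hJ => by
    have hJ' : Jn (a' :: x) v := Jn_suffix (p := [a]) (by simpa using hs) (by simp) (by simpa using hJ)
    have := desL_append (a' :: x) v (List.Pairwise.of_cons hs) (by simp) hv hJ'
    simp only [List.cons_append] at this ⊢
    rw [desL_cons_cons, this, if_neg, add_zero]
    have := (List.pairwise_cons.mp hs).1 a' (by simp)
    omega

theorem run_exists : ∀ (l : List ℕ), l.Nodup → l ≠ [] →
    ∃ u v, l = u ++ v ∧ u ≠ [] ∧ u.Pairwise (· < ·) ∧ Jn u v
  | [], _, h => absurd rfl h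
  | [a], _, _ => ⟨[a], [], by simp, by simp, by simp, by intro b q h; simp at h⟩
  | a :: b :: l, hn, _ => by
    obtain ⟨u, v, h1, h2, h3, h4⟩ := run_exists (b :: l) (List.Nodup.of_cons hn) (by simp)
    rcases lt_or_ge a b with hab | hab
    · rcases u with _ | ⟨c, u⟩
      · exact absurd rfl h2
      · have hcb : b = c := by
          have := congrArg List.head? h1
          simpa using this
        subst hcb
        refine ⟨a :: b :: u, v, by simp [h1], by simp, ?_, ?_⟩
        · rw [List.pairwise_cons]
          refine ⟨?_, h3⟩
          intro d hd
          rcases List.mem_cons.mp hd with rfl | hd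
          · exact hab
          · exact hab.trans ((List.pairwise_cons.mp h3).1 d hd)
        · intro d q hq
          obtain ⟨e, he, hlt⟩ := h4 d q hq
          exact ⟨e, by simp_all, hlt⟩
    · refine ⟨[a], b :: l, by simp, by simp, by simp, ?_⟩
      intro d q hq
      have hdb : b = d := by simpa using congrArg List.head? hq
      subst hdb
      refine ⟨a, by simp, lt_of_le_of_ne hab ?_⟩
      rintro rfl
      simp at hn

/-- all arrangements of a finite set -/
noncomputable def perms (T : Finset ℕ) : Finset (List ℕ) := T.toList.permutations.toFinset

theorem mem_perms {T : Finset ℕ} {l : List ℕ} : l ∈ perms T ↔ l.Nodup ∧ l.toFinset = T := by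
  unfold perms
  rw [List.mem_toFinset, List.mem_permutations]
  constructor
  · intro h
    refine ⟨h.nodup_iff.mpr T.nodup_toList, ?_⟩
    rw [List.toFinset_eq_of_perm _ _ h, Finset.toList_toFinset]
  · rintro ⟨h1, h2⟩
    apply List.perm_of_nodup_nodup_toFinset_eq h1 T.nodup_toList
    rw [h2, Finset.toList_toFinset]

/-- increasing arrangement -/
def srt (T : Finset ℕ) : List ℕ := T.sort (· ≤ ·)

theorem srt_sorted (T : Finset ℕ) : (srt T).Pairwise (· < ·) :=
  (Finset.sortedLT_sort T).pairwise

theorem srt_toFinset (T : Finset ℕ) : (srt T).toFinset = T := Finset.sort_toFinset T _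

theorem srt_length (T : Finset ℕ) : (srt T).length = T.card := Finset.length_sort _

theorem mem_srt {T : Finset ℕ} {a : ℕ} : a ∈ srt T ↔ a ∈ T := Finset.mem_sort _

theorem srt_nodup (T : Finset ℕ) : (srt T).Nodup := Finset.sort_nodup T _

theorem srt_ne_nil {T : Finset ℕ} (h : T.Nonempty) : srt T ≠ [] := by
  obtain ⟨a, ha⟩ := h
  intro h'
  have := mem_srt.mpr ha
  simp [h'] at this

theorem srt_of_sorted {u : List ℕ} (h : u.Pairwise (· < ·)) : srt u.toFinset = u := by
  have hn : u.Nodup := h.imp (fun h => Nat.ne_of_lt h)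
  apply List.Perm.eq_of_pairwise (le := (· < ·)) _ (srt_sorted _) h
  · exact List.perm_of_nodup_nodup_toFinset_eq (srt_nodup _) hn (srt_toFinset _)
  · intro a b _ _ h1 h2
    omega

open scoped Classical in
theorem run_sum (T : Finset ℕ) (hT : T.Nonempty) (f : List ℕ → Polynomial ℚ) :
    ∑ l ∈ perms T, f l = ∑ Y ∈ T.powerset, if Y.Nonempty then
      ∑ l ∈ perms (T \ Y), (if Jn (srt Y) l then f (srt Y ++ l) else 0) else 0 := by
  simp only [← Finset.sum_filter]
  rw [Finset.sum_sigma']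
  symm
  refine Finset.sum_bij (fun p _ => srt p.1 ++ p.2) ?_ ?_ ?_ ?_
  · rintro ⟨Y, l⟩ h
    simp only [Finset.mem_sigma, Finset.mem_filter, Finset.mem_powerset, mem_perms] at h ⊢
    obtain ⟨⟨hY, hYn⟩, ⟨hl, hlT⟩, -⟩ := h
    constructor
    · rw [List.nodup_append']
      refine ⟨srt_nodup _, hl, ?_⟩
      intro a ha ha'
      have h1 : a ∈ T \ Y := by rw [← hlT]; simpa using ha'
      exact (Finset.mem_sdiff.mp h1).2 (mem_srt.mp ha)
    · rw [List.toFinset_append, srt_toFinset, hlT, Finset.union_sdiff_of_subset hY]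
  · rintro ⟨Y, l⟩ h ⟨Y', l'⟩ h' heq
    simp only [Finset.mem_sigma, Finset.mem_filter] at h h' heq
    obtain ⟨h1, h2⟩ := Jn_unique (srt_sorted _) (srt_sorted _) h.2.2 h'.2.2 heq
    have h3 : Y = Y' := by rw [← srt_toFinset Y, h1, srt_toFinset]
    subst h3
    subst h2
    rfl
  · intro l hl
    rw [mem_perms] at hl
    obtain ⟨u, v, h1, h2, h3, h4⟩ := run_exists l hl.1 (by
      rintro rfl
      simp at hl
      simp [← hl] at hT)
    subst h1
    have hnd := List.nodup_append'.mp hl.1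
    refine ⟨⟨u.toFinset, v⟩, ?_, ?_⟩
    · simp only [Finset.mem_sigma, Finset.mem_filter, Finset.mem_powerset, mem_perms]
      rw [srt_of_sorted h3, ← hl.2, List.toFinset_append]
      refine ⟨⟨Finset.subset_union_left, ?_⟩, ⟨hnd.2.1, ?_⟩, h4⟩
      · rwa [List.toFinset_nonempty_iff]
      · rw [Finset.union_sdiff_cancel_left]
        rw [Finset.disjoint_left]
        intro a ha ha'
        exact hnd.2.2 (by simpa using ha) (by simpa using ha')
    · simp [srt_of_sorted h3]
  · intro p _
    rfl

theorem hasMatch_iff (Γ : Set (List ℕ)) (l : List ℕ) :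
    HasMatch Γ l ↔ ∃ p w q, p ++ (w ++ q) = l ∧ 2 ≤ w.length ∧ redL w ∈ Γ := by
  constructor
  · rintro ⟨i, j, hj, hl, hm⟩
    refine ⟨l.take i, (l.drop i).take (j + 1), (l.drop i).drop (j + 1), ?_, ?_, hm⟩
    · rw [List.take_append_drop, List.take_append_drop]
    · rw [List.length_take, List.length_drop]
      omega
  · rintro ⟨p, w, q, rfl, hw, hm⟩
    refine ⟨p.length, w.length - 1, by omega, by simp; omega, ?_⟩
    rw [List.drop_left, Nat.sub_add_cancel (by omega), List.take_left]
    exact hm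

theorem rk_lt {w : List ℕ} {x y : ℕ} (hx : x ∈ w) (h : x < y) :
    w.countP (fun z => decide (z < x)) < w.countP (fun z => decide (z < y)) := by
  induction w with
  | nil => simp at hx
  | cons a w ih =>
    have hle : w.countP (fun z => decide (z < x)) ≤ w.countP (fun z => decide (z < y)) := by
      apply List.countP_mono_left
      intro z _ hz
      simp only [decide_eq_true_eq] at hz ⊢
      omega
    simp only [List.countP_cons, decide_eq_true_eq]
    rcases List.mem_cons.mp hx with rfl | hx
    · rw [if_neg (lt_irrefl _), if_pos h]
      omega
    · have := ih hx
      split_ifs <;> omega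

theorem rk_lt_iff {w : List ℕ} {x y : ℕ} (hx : x ∈ w) (hy : y ∈ w) :
    w.countP (fun z => decide (z < x)) < w.countP (fun z => decide (z < y)) ↔ x < y := by
  refine ⟨fun h => ?_, rk_lt hx⟩
  by_contra hlt
  rcases eq_or_lt_of_le (not_lt.mp hlt) with rfl | h'
  · exact lt_irrefl _ h
  · have := rk_lt hy h'
    omega

theorem redL_length (w : List ℕ) : (redL w).length = w.length := by simp [redL]

theorem redL_pairwise {w : List ℕ} :
    (redL w).Pairwise (· < ·) ↔ w.Pairwise (· < ·) := by
  unfold redL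
  rw [List.pairwise_map]
  apply List.Pairwise.iff_of_mem
  intro a b ha hb
  rw [add_lt_add_iff_right]
  exact rk_lt_iff ha hb

theorem redL_perm {w : List ℕ} (hw : w.Nodup) : (redL w).Perm (List.range' 1 w.length) := by
  apply List.Subperm.perm_of_length_le
  · apply List.subperm_of_subset
    · unfold redL
      apply List.Nodup.map_on _ hw
      intro x hx y hy h
      rcases lt_trichotomy x y with h' | h' | h'
      · have := rk_lt hx h'
        omega
      · exact h'
      · have := rk_lt hy h'
        omega
    · intro z hz
      unfold redL at hz
      obtain ⟨x, hx, rfl⟩ := List.mem_map.mp hz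
      rw [List.mem_range'_1]
      have h1 : w.countP (fun z => decide (z < x)) < w.length := by
        refine lt_of_le_of_ne List.countP_le_length ?_
        intro h
        rw [List.countP_eq_length] at h
        simpa using h x hx
      omega
  · rw [redL_length, List.length_range']

theorem redL_range' {w : List ℕ} (hw : w.Nodup) (m : ℕ) :
    redL w = List.range' 1 m ↔ w.length = m ∧ w.Pairwise (· < ·) := by
  constructor
  · intro h
    constructor
    · rw [← redL_length, h, List.length_range']
    · rw [← redL_pairwise, h]
      exact List.pairwise_lt_range'
  · rintro ⟨rfl, h⟩
    apply List.Perm.eq_of_pairwise (le := (· < ·)) _ (redL_pairwise.mpr h)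
      List.pairwise_lt_range' (redL_perm hw)
    intro a b _ _ h1 h2
    omega

theorem redL_getD {w : List ℕ} {i : ℕ} (h : i < w.length) :
    (redL w).getD i 0 = w.countP (fun z => decide (z < w[i])) + 1 := by
  rw [List.getD_eq_getElem _ _ (by rw [redL_length]; exact h)]
  simp [redL]

theorem redL_getD_lt {w : List ℕ} {i j : ℕ} (hi : i < w.length) (hj : j < w.length) :
    (redL w).getD i 0 < (redL w).getD j 0 ↔ w[i] < w[j] := by
  rw [redL_getD hi, redL_getD hj, add_lt_add_iff_right]
  exact rk_lt_iff (List.getElem_mem hi) (List.getElem_mem hj)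

theorem countP_compl {u : List ℕ} {b : ℕ} (h : b ∉ u) :
    u.length = u.countP (fun z => decide (z < b)) + u.countP (fun z => decide (b < z)) := by
  rw [List.length_eq_countP_add_countP (fun z => decide (z < b))]
  congr 1
  apply List.countP_congr
  intro z hz
  have : z ≠ b := by rintro rfl; exact h hz
  simp only [decide_eq_true_eq]
  omega

theorem redL_GammaK {k : ℕ} (hk : 2 ≤ k) {w : List ℕ} (hw : w.Nodup) :
    redL w ∈ GammaK k k ↔ ∃ u b v, w = u ++ b :: v ∧ u.length = k ∧ (b :: v).length = k ∧
      u.Pairwise (· < ·) ∧ (b :: v).Pairwise (· < ·) ∧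
      u.countP (fun z => decide (b < z)) = k - 1 := by
  constructor
  · rintro ⟨h1, -, h3, h4, h5, h6⟩
    rw [redL_length] at h1
    have hu : (w.take k).Pairwise (· < ·) := by
      rw [← List.isChain_iff_pairwise, List.isChain_iff_getElem]
      intro i hi
      rw [List.length_take] at hi
      rw [List.getElem_take, List.getElem_take]
      exact (redL_getD_lt (by omega) (by omega)).mp (h5 i (by omega))
    have hv : (w.drop k).Pairwise (· < ·) := by
      rw [← List.isChain_iff_pairwise, List.isChain_iff_getElem]
      intro i hi
      rw [List.length_drop] at hi
      rw [List.getElem_drop, List.getElem_drop]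
      exact (redL_getD_lt (by omega) (by omega)).mp (h6 (k + i) (by omega) (by omega))
    have hlu : (w.take k).length = k := by rw [List.length_take]; omega
    have hlv : (w.drop k).length = k := by rw [List.length_drop]; omega
    have hkw : k < w.length := by omega
    rw [redL_getD hkw] at h4
    have hd : w.drop k = w[k] :: w.drop (k + 1) := List.drop_eq_getElem_cons hkw
    refine ⟨w.take k, w[k], w.drop (k + 1), ?_, hlu, hd ▸ hlv, hu, hd ▸ hv, ?_⟩
    · rw [← hd, List.take_append_drop]
    · have hsplit : w = w.take k ++ (w[k] :: w.drop (k + 1)) := by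
        rw [← hd, List.take_append_drop]
      have hnd : (w.take k ++ (w[k] :: w.drop (k + 1))).Nodup := hsplit ▸ hw
      have hb : w[k] ∉ w.take k := fun h => (List.nodup_append'.mp hnd).2.2 h List.mem_cons_self
      have h7 := countP_compl hb
      rw [hlu] at h7
      generalize w[k] = b at *
      rw [hsplit, List.countP_append] at h4
      have h8 : (b :: w.drop (k + 1)).countP (fun z => decide (z < b)) = 0 := by
        rw [List.countP_eq_zero]
        intro a ha
        rw [hd, List.pairwise_cons] at hv
        simp only [decide_eq_true_eq]
        rcases List.mem_cons.mp ha with rfl | ha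
        · omega
        · have := hv.1 a ha
          omega
      rw [h8] at h4
      omega
  · rintro ⟨u, b, v, rfl, hlu, hlv, hu, hv, hc⟩
    have hlen : (u ++ b :: v).length = k + k := by rw [List.length_append, hlu, hlv]
    have hb : b ∉ u := fun h => (List.nodup_append'.mp hw).2.2 h (by simp)
    have h7 := countP_compl hb
    have hvb := (List.pairwise_cons.mp hv).1
    have h8 : (b :: v).countP (fun z => decide (z < b)) = 0 := by
      rw [List.countP_eq_zero]
      intro a ha
      simp only [decide_eq_true_eq]
      rcases List.mem_cons.mp ha with rfl | ha
      · omega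
      · have := hvb a ha
        omega
    refine ⟨by rw [redL_length, hlen], hlen ▸ redL_perm hw, ?_, ?_, ?_, ?_⟩
    · rw [redL_getD (by omega)]
      rcases u with _ | ⟨a, u⟩
      · simp at hlu; omega
      simp only [List.cons_append, List.getElem_cons_zero]
      have hua := (List.pairwise_cons.mp hu).1
      have hab : a < b := by
        by_contra hlt
        have : (a :: u).countP (fun z => decide (z < b)) = 0 := by
          rw [List.countP_eq_zero]
          intro c hc
          simp only [decide_eq_true_eq]
          rcases List.mem_cons.mp hc with rfl | hc
          · omega
          · have := hua c hc
            omega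
        omega
      rw [Nat.add_eq_right, List.countP_eq_zero]
      intro c hc
      simp only [decide_eq_true_eq]
      simp only [List.mem_cons, List.mem_append] at hc
      rcases hc with rfl | hc | rfl | hc
      · omega
      · have := hua c hc
        omega
      · omega
      · have := hvb c hc
        omega
    · rw [redL_getD (by omega)]
      have : (u ++ b :: v)[k]'(by omega) = b := by
        rw [List.getElem_append_right (by omega)]
        simp [hlu]
      rw [this, List.countP_append, h8]
      omega
    · intro i hi
      rw [redL_getD_lt (by omega) (by omega), List.getElem_append_left (by omega),
        List.getElem_append_left (by omega)]
      exact List.pairwise_iff_getElem.mp hu _ _ _ _ (by omega)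
    · intro i hi hi'
      rw [redL_getD_lt (by omega) (by omega), List.getElem_append_right (by omega),
        List.getElem_append_right (by omega)]
      exact List.pairwise_iff_getElem.mp hv _ _ _ _ (by omega)

theorem countP_suffix {p c : List ℕ} {b k : ℕ} (hk : 2 ≤ k) (hs : (p ++ c).Pairwise (· < ·))
    (hc : c.length = k) :
    (p ++ c).countP (fun z => decide (b < z)) = k - 1 ↔
      c.countP (fun z => decide (b < z)) = k - 1 := by
  rw [List.countP_append]
  by_cases h : ∃ e ∈ p, b < e
  · obtain ⟨e, he, hbe⟩ := h
    have : c.countP (fun z => decide (b < z)) = c.length := by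
      rw [List.countP_eq_length]
      intro a ha
      have := (List.pairwise_append.mp hs).2.2 e he a ha
      simp only [decide_eq_true_eq]
      omega
    omega
  · have : p.countP (fun z => decide (b < z)) = 0 := by
      rw [List.countP_eq_zero]
      intro a ha
      simp only [decide_eq_true_eq]
      exact fun h' => h ⟨a, ha, h'⟩
    omega

/-- matching factors, described directly -/
theorem mem_Gamma {k s : ℕ} (hk : 2 ≤ k) {w : List ℕ} (hw : w.Nodup) :
    redL w ∈ GammaK k k ∪ {List.range' 1 (s + 1)} ↔
      (w.length = s + 1 ∧ w.Pairwise (· < ·)) ∨ ∃ u b v, w = u ++ b :: v ∧ u.length = k ∧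
        (b :: v).length = k ∧ u.Pairwise (· < ·) ∧ (b :: v).Pairwise (· < ·) ∧
        u.countP (fun z => decide (b < z)) = k - 1 := by
  rw [Set.mem_union, Set.mem_singleton_iff, redL_GammaK hk hw, redL_range' hw, or_comm]

theorem not_sorted_aux {k : ℕ} (hk : 2 ≤ k) {u v : List ℕ} {b : ℕ}
    (hc : u.countP (fun z => decide (b < z)) = k - 1) : Jn u (b :: v) := by
  intro b' q h
  obtain ⟨rfl, rfl⟩ := List.cons_eq_cons.mp h
  obtain ⟨a, ha, h⟩ := List.countP_pos_iff.mp (show 0 < u.countP (fun z => decide (b < z)) by omega)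
  exact ⟨a, ha, by simpa using h⟩

theorem hasMatch_sorted {k s : ℕ} (hk : 2 ≤ k) (hs : k ≤ s) {x w : List ℕ}
    (hx : x.Pairwise (· < ·)) (hwx : w <:+: x)
    (hm : redL w ∈ GammaK k k ∪ {List.range' 1 (s + 1)}) : s + 1 ≤ x.length := by
  have hw : w.Pairwise (· < ·) := hx.sublist hwx.sublist
  have hn : w.Nodup := hw.imp (fun h => Nat.ne_of_lt h)
  rcases (mem_Gamma hk hn).mp hm with ⟨h, -⟩ | ⟨u, b, v, rfl, -, -, -, -, hc⟩
  · have := hwx.length_le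
    omega
  · have := Jn_unique_aux hw rfl (not_sorted_aux (v := v ++ []) hk hc)
    simp at this

theorem hasMatch_long {k s : ℕ} (hk : 2 ≤ k) (hs : k ≤ s) {x v : List ℕ}
    (hx : x.Pairwise (· < ·)) (h : s + 1 ≤ x.length) :
    HasMatch (GammaK k k ∪ {List.range' 1 (s + 1)}) (x ++ v) := by
  rw [hasMatch_iff]
  refine ⟨[], x.take (s + 1), x.drop (s + 1) ++ v, ?_, ?_, ?_⟩
  · rw [List.nil_append, ← List.append_assoc, List.take_append_drop]
  · rw [List.length_take]; omega
  · have hw : (x.take (s + 1)).Pairwise (· < ·) := hx.sublist (List.take_sublist _ _)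
    rw [mem_Gamma hk (hw.imp (fun h => Nat.ne_of_lt h))]
    left
    refine ⟨?_, hw⟩
    rw [List.length_take]; omega

theorem hasMatch_append {k s : ℕ} (hk : 2 ≤ k) (hs : k ≤ s) {x y' l : List ℕ} {b : ℕ}
    (hx : x.Pairwise (· < ·)) (hy : (b :: y').Pairwise (· < ·))
    (hn : (x ++ (b :: y' ++ l)).Nodup) (hJx : Jn x (b :: y')) (hJy : Jn (b :: y') l) :
    HasMatch (GammaK k k ∪ {List.range' 1 (s + 1)}) (x ++ (b :: y' ++ l)) ↔
      s + 1 ≤ x.length ∨ HasMatch (GammaK k k ∪ {List.range' 1 (s + 1)}) (b :: y' ++ l) ∨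
      (k ≤ x.length ∧ k ≤ (b :: y').length ∧ x.countP (fun z => decide (b < z)) = k - 1) := by
  constructor
  · intro h
    obtain ⟨p, w, q, heq, hw, hm⟩ := (hasMatch_iff _ _).mp h
    have hnw : w.Nodup := hn.sublist (heq ▸ (List.infix_append' p w q).sublist)
    rcases List.append_eq_append_iff.mp heq with ⟨c, h1, h2⟩ | ⟨c, h1, h2⟩
    swap
    · right; left
      rw [hasMatch_iff]
      exact ⟨c, w, q, h2.symm, hw, hm⟩
    rcases List.append_eq_append_iff.mp h2 with ⟨d, h3, h4⟩ | ⟨d, h3, h4⟩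
    · left
      refine hasMatch_sorted hk hs hx ?_ hm
      rw [h1, h3, ← List.append_assoc]
      exact List.infix_append _ _ _
    -- `w = c ++ d` straddles
    by_cases hd : d = []
    · left
      refine hasMatch_sorted hk hs hx ?_ hm
      rw [h1, h3, hd, List.append_nil]
      exact (List.suffix_append _ _).isInfix
    by_cases hc : c = []
    · right; left
      rw [hasMatch_iff]
      refine ⟨[], w, q, ?_, hw, hm⟩
      rw [h3, hc, h4]
      simp
    subst h3
    subst h1
    have hcs : c.Pairwise (· < ·) := (List.pairwise_append.mp hx).2.1
    obtain ⟨b', d', rfl⟩ := List.exists_cons_of_ne_nil hd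
    have hbb : b = b' := by simpa using congrArg List.head? h4
    subst hbb
    have hJc : Jn c (b :: d') := by
      intro e r her
      obtain ⟨rfl, rfl⟩ := List.cons_eq_cons.mp her
      exact Jn_suffix hx hc hJx b y' rfl
    rcases (mem_Gamma hk hnw).mp hm with ⟨-, h⟩ | ⟨u, e, v, h5, hlu, hlv, hu, hv, hcnt⟩
    · have := Jn_unique_aux (l' := []) h (by simp) hJc
      simp at this
    · obtain ⟨rfl, h6⟩ := Jn_unique hcs hu hJc (not_sorted_aux hk hcnt) h5
      obtain ⟨rfl, rfl⟩ := List.cons_eq_cons.mp h6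
      right; right
      refine ⟨by rw [List.length_append]; omega, ?_, (countP_suffix hk hx hlu).mpr hcnt⟩
      rcases List.append_eq_append_iff.mp h4 with ⟨f, h7, h8⟩ | ⟨f, h7, h8⟩
      · rw [h7] at hv
        have := Jn_unique_aux hv h8 hJy
        rw [this, List.append_nil] at h7
        rw [← h7]; omega
      · rw [h7, List.length_append]; omega
  · rintro (h | h | ⟨h1, h2, h3⟩)
    · exact hasMatch_long hk hs hx h
    · rw [hasMatch_iff] at h ⊢
      obtain ⟨p, w, q, heq, hw, hm⟩ := h
      exact ⟨x ++ p, w, q, by rw [← heq, List.append_assoc], hw, hm⟩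
    · rw [hasMatch_iff]
      set p := x.take (x.length - k) with hp
      set u := x.drop (x.length - k) with hu
      have hxs : x = p ++ u := (List.take_append_drop _ _).symm
      have hlu : u.length = k := by rw [hu, List.length_drop]; omega
      obtain ⟨j, rfl⟩ : ∃ j, k = j + 1 := ⟨k - 1, by omega⟩
      have e : (x ++ (b :: y' ++ l)) = p ++ ((u ++ b :: y'.take j) ++ (y'.drop j ++ l)) := by
        rw [hxs]
        simp only [List.append_assoc, List.cons_append]
        rw [← List.append_assoc (y'.take j), List.take_append_drop]
      have hnw : (u ++ b :: y'.take j).Nodup := by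
        rw [e] at hn
        exact hn.sublist (List.infix_append' _ _ _).sublist
      refine ⟨p, u ++ b :: y'.take j, y'.drop j ++ l, e.symm, ?_, ?_⟩
      · rw [List.length_append]; omega
      · rw [mem_Gamma hk hnw]
        right
        rw [hxs] at hx h3
        refine ⟨u, b, y'.take j, rfl, hlu, ?_, (List.pairwise_append.mp hx).2.1, ?_,
          (countP_suffix hk hx hlu).mp h3⟩
        · simp only [List.length_cons, List.length_take] at h2 ⊢
          omega
        · exact hy.sublist (List.Sublist.cons_cons _ (List.take_sublist _ _))

theorem cAb_eq_countP {A Y : Finset ℕ} {b : ℕ} {y' : List ℕ} (hY : srt Y = b :: y') :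
    cAb A Y = (srt A).countP (fun z => decide (b < z)) := by
  have hs := srt_sorted Y
  rw [hY] at hs
  have h1 : ∀ x, (∃ t ∈ Y, t < x) ↔ b < x := by
    intro x
    constructor
    · rintro ⟨t, ht, htx⟩
      rw [← mem_srt, hY] at ht
      rcases List.mem_cons.mp ht with rfl | ht
      · exact htx
      · exact ((List.pairwise_cons.mp hs).1 t ht).trans htx
    · intro h
      exact ⟨b, by rw [← mem_srt, hY]; simp, h⟩
  unfold cAb
  simp only [h1]
  rw [List.countP_eq_length_filter, ← List.toFinset_card_of_nodup ((srt_nodup A).filter _),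
    List.toFinset_filter, srt_toFinset]
  simp

theorem Jn_iff {A Y : Finset ℕ} {b : ℕ} {y' l : List ℕ} (hY : srt Y = b :: y') :
    Jn (srt A) (srt Y ++ l) ↔ cAb A Y ≠ 0 := by
  rw [cAb_eq_countP hY, Nat.ne_zero_iff_zero_lt, List.countP_pos_iff, hY]
  constructor
  · intro h
    obtain ⟨a, ha, hlt⟩ := h b (y' ++ l) rfl
    exact ⟨a, ha, by simpa using hlt⟩
  · rintro ⟨a, ha, hlt⟩ b' q h
    rw [List.cons_append] at h
    obtain ⟨rfl, rfl⟩ := List.cons_eq_cons.mp h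
    exact ⟨a, ha, by simpa using hlt⟩

open scoped Classical in
/-- weight of match-free arrangements of `S` -/
noncomputable def Nw (Γ : Set (List ℕ)) (S : Finset ℕ) : Polynomial ℚ :=
  if S = ∅ then 1 else ∑ l ∈ perms S, if ¬ HasMatch Γ l then X ^ (1 + desL l) else 0

open scoped Classical in
/-- weight of match-free arrangements with prescribed first run -/
noncomputable def Bw (Γ : Set (List ℕ)) (A T : Finset ℕ) : Polynomial ℚ :=
  ∑ l ∈ perms T, if Jn (srt A) l then
    (if ¬ HasMatch Γ (srt A ++ l) then X ^ (1 + desL (srt A ++ l)) else 0) else 0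

open scoped Classical in
theorem Nw_eq (Γ : Set (List ℕ)) (S : Finset ℕ) (hS : S.Nonempty) :
    Nw Γ S = ∑ Y ∈ S.powerset, if Y.Nonempty then Bw Γ Y (S \ Y) else 0 := by
  rw [Nw, if_neg hS.ne_empty, run_sum S hS]
  rfl

theorem perms_empty : perms ∅ = {[]} := by
  ext l
  rw [mem_perms]
  simp only [List.toFinset_eq_empty_iff, Finset.mem_singleton]
  constructor
  · exact fun h => h.2
  · rintro rfl; simp

open scoped Classical in
theorem Bw_eq (k s : ℕ) (hk : 2 ≤ k) (hs : k ≤ s) (A T : Finset ℕ) (hA : A.Nonempty)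
    (hd : Disjoint A T) :
    Bw (GammaK k k ∪ {List.range' 1 (s + 1)}) A T =
      if A.card ≤ s then
        X * (if T = ∅ then 1 else
          ∑ Y ∈ T.powerset, if Y.Nonempty ∧ ¬ Red k A Y then
            Bw (GammaK k k ∪ {List.range' 1 (s + 1)}) Y (T \ Y) else 0)
      else 0 := by
  set Γ := GammaK k k ∪ {List.range' 1 (s + 1)} with hΓ
  by_cases hAs : A.card ≤ s
  swap
  · rw [if_neg hAs, Bw]
    apply Finset.sum_eq_zero
    intro l _
    have : HasMatch Γ (srt A ++ l) :=
      hasMatch_long hk hs (srt_sorted A) (by rw [srt_length]; omega)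
    simp [this]
  rw [if_pos hAs]
  by_cases hT : T = ∅
  · subst hT
    rw [if_pos rfl, Bw, perms_empty, Finset.sum_singleton, List.append_nil, if_pos, if_pos,
      desL_sorted _ (srt_sorted A)]
    · simp
    · intro h
      obtain ⟨p, w, q, h1, -, h2⟩ := (hasMatch_iff _ _).mp h
      have := hasMatch_sorted hk hs (srt_sorted A) (w := w)
        (by rw [← h1, ← List.append_assoc]; exact List.infix_append _ _ _) h2
      rw [srt_length] at this
      omega
    · intro b q h
      simp at h
  rw [if_neg hT, Bw, run_sum T (Finset.nonempty_iff_ne_empty.mpr hT), Finset.mul_sum]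
  apply Finset.sum_congr rfl
  intro Y hY
  rw [Finset.mem_powerset] at hY
  by_cases hYn : Y.Nonempty
  swap
  · simp [hYn]
  obtain ⟨b, y', hby⟩ := List.exists_cons_of_ne_nil (srt_ne_nil hYn)
  rw [if_pos hYn, mul_ite, mul_zero, Bw, Finset.mul_sum]
  have key : ∀ l ∈ perms (T \ Y), Jn (srt Y) l → (if Jn (srt A) (srt Y ++ l) then
      (if ¬ HasMatch Γ (srt A ++ (srt Y ++ l)) then
        (X : Polynomial ℚ) ^ (1 + desL (srt A ++ (srt Y ++ l))) else 0) else 0) =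
      if ¬ Red k A Y then X * (if ¬ HasMatch Γ (srt Y ++ l) then
        X ^ (1 + desL (srt Y ++ l)) else 0) else 0 := by
    intro l hl hJ
    rw [mem_perms] at hl
    by_cases hc0 : cAb A Y = 0
    · rw [if_neg (by rw [Jn_iff hby]; exact fun h => h hc0),
        if_neg (not_not.mpr (show Red k A Y from Or.inl hc0))]
    have hJA := (Jn_iff (A := A) (l := l) hby).mpr hc0
    have hJA' := (Jn_iff (A := A) (l := []) hby).mpr hc0
    rw [List.append_nil] at hJA'
    rw [if_pos hJA]
    have hnd : (srt A ++ (srt Y ++ l)).Nodup := by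
      rw [List.nodup_append']
      refine ⟨srt_nodup A, ?_, ?_⟩
      · rw [List.nodup_append']
        refine ⟨srt_nodup Y, hl.1, ?_⟩
        intro a ha ha'
        have h1 : a ∈ T \ Y := by rw [← hl.2]; simpa using ha'
        exact (Finset.mem_sdiff.mp h1).2 (mem_srt.mp ha)
      · intro a ha ha'
        refine Finset.disjoint_left.mp hd (mem_srt.mp ha) ?_
        rcases List.mem_append.mp ha' with h | h
        · exact hY (mem_srt.mp h)
        · have h1 : a ∈ T \ Y := by rw [← hl.2]; simpa using h
          exact (Finset.mem_sdiff.mp h1).1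
    rw [desL_append (srt A) _ (srt_sorted A) (srt_ne_nil hA) (by simp [hby]) hJA]
    have hm : HasMatch Γ (srt A ++ (srt Y ++ l)) ↔ Red k A Y ∨ HasMatch Γ (srt Y ++ l) := by
      have hYs := srt_sorted Y
      unfold Red
      rw [cAb_eq_countP hby, ← srt_length A, ← srt_length Y]
      rw [cAb_eq_countP hby] at hc0
      rw [hby] at hYs hnd hJA' hJ ⊢
      rw [hΓ, hasMatch_append hk hs (srt_sorted A) hYs hnd hJA' hJ, srt_length A]
      have : ¬ (s + 1 ≤ A.card) := by omega
      tauto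
    rw [hm]
    by_cases h1 : Red k A Y
    · simp [h1]
    · by_cases h2 : HasMatch Γ (srt Y ++ l)
      · simp [h1, h2]
      · simp only [h1, h2, or_self, not_false_eq_true, if_true]
        ring
  by_cases hR : Red k A Y
  · rw [if_neg (fun h => h.2 hR)]
    apply Finset.sum_eq_zero
    intro l hl
    by_cases hJ : Jn (srt Y) l
    · rw [if_pos hJ, key l hl hJ, if_neg (not_not.mpr hR)]
    · rw [if_neg hJ]
  · rw [if_pos ⟨hYn, hR⟩]
    apply Finset.sum_congr rfl
    intro l hl
    by_cases hJ : Jn (srt Y) l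
    · rw [if_pos hJ, key l hl hJ, if_pos hR, if_pos hJ]
    · rw [if_neg hJ, if_neg hJ, mul_zero]

theorem NMpoly_eq (Γ : Set (List ℕ)) (n : ℕ) : NMpoly Γ n = Nw Γ (Finset.Icc 1 n) := by
  classical
  unfold NMpoly Nw
  by_cases hn : n = 0
  · subst hn; simp
  · rw [if_neg hn, if_neg, NMfinset, Finset.sum_filter]
    · have : (List.range' 1 n).permutations.toFinset = perms (Finset.Icc 1 n) := by
        ext l
        rw [mem_perms, List.mem_toFinset, List.mem_permutations]
        have hr : (List.range' 1 n).toFinset = Finset.Icc 1 n := by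
          ext a
          simp only [List.mem_toFinset, List.mem_range'_1, Finset.mem_Icc]
          omega
        constructor
        · intro h
          exact ⟨h.nodup_iff.mpr List.nodup_range', by rw [List.toFinset_eq_of_perm _ _ h, hr]⟩
        · rintro ⟨h1, h2⟩
          exact List.perm_of_nodup_nodup_toFinset_eq h1 List.nodup_range' (by rw [h2, hr])
      rw [this]
    · intro h
      have := congrArg Finset.card h
      simp at this
      omega

/-- the universal sequence, extended by zero -/
noncomputable def vz (k s : ℕ) (m : ℤ) : Polynomial ℚ :=
  if m < 0 then 0 else Ww k s (Finset.range m.toNat)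

theorem vz_neg (k s : ℕ) (m : ℤ) (h : m < 0) : vz k s m = 0 := if_pos h

theorem vz_nat (k s n : ℕ) : vz k s n = Ww k s (Finset.range n) := by
  unfold vz
  rw [if_neg (by omega)]
  simp

theorem Ww_card (k s : ℕ) (hk : 2 ≤ k) (hs : k ≤ s) : ∀ n : ℕ, ∀ S : Finset ℕ, S.card = n →
    Ww k s S = vz k s n := by
  intro n
  induction n using Nat.strong_induction_on with
  | _ n ih =>
  intro S hS
  rcases Nat.eq_zero_or_pos n with h | h
  · subst h
    rw [Finset.card_eq_zero] at hS
    subst hS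
    rw [vz_nat]
    simp
  · have hv : ∀ A : Finset ℕ, A.card < n → Ww k s A = vz k s A.card := fun A hA => ih _ hA A rfl
    have h1 := Ww_formula k s hk hs (vz k s) (vz_neg k s) S (Finset.card_pos.mp (by omega))
      (fun A hA => hv A (by omega))
    have h2 := Ww_formula k s hk hs (vz k s) (vz_neg k s) (Finset.range n)
      (Finset.card_pos.mp (by simpa using h)) (fun A hA => hv A (by simpa using hA))
    rw [vz_nat, h2, h1, hS, Finset.card_range]

theorem sum_card_aux (S : Finset ℕ) (g : ℕ → Polynomial ℚ) :
    ∑ C ∈ S.powerset, g C.card = ∑ m ∈ Finset.range (S.card + 1), (S.card.choose m) • g m := by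
  rw [Finset.sum_powerset_apply_card]

theorem Nw_card (k s : ℕ) (hk : 2 ≤ k) (hs : k ≤ s) : ∀ n : ℕ, ∀ S : Finset ℕ, S.card = n →
    Nw (GammaK k k ∪ {List.range' 1 (s + 1)}) S =
      NMpoly (GammaK k k ∪ {List.range' 1 (s + 1)}) n := by
  classical
  set Γ := GammaK k k ∪ {List.range' 1 (s + 1)} with hΓ
  intro n
  induction n using Nat.strong_induction_on with
  | _ n ih =>
  intro S hS
  rcases Nat.eq_zero_or_pos n with h | h
  · subst h
    rw [Finset.card_eq_zero] at hS
    subst hS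
    rw [NMpoly_eq]
    simp
  have key : ∀ S : Finset ℕ, S.card = n → Nw Γ S =
      - ∑ C ∈ S.powerset, if C.card = 0 then 0 else vz k s C.card * NMpoly Γ (n - C.card) := by
    intro S hS
    have h1 := inv_main k s (Nw Γ) (Bw Γ) (by simp [Nw]) (Nw_eq Γ)
      (fun A T hA hd => Bw_eq k s hk hs A T hA hd) S (Finset.card_pos.mp (by omega))
    have h2 : ∀ C ∈ S.powerset, Ww k s C * Nw Γ (S \ C) = (if C = ∅ then Nw Γ S else 0) +
        if C.card = 0 then 0 else vz k s C.card * NMpoly Γ (n - C.card) := by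
      intro C hC
      rw [Finset.mem_powerset] at hC
      by_cases hC0 : C = ∅
      · subst hC0
        simp [Ww]
      · have hCn := Finset.nonempty_iff_ne_empty.mpr hC0
        have hlt := sdiff_card_lt_aux hC hCn
        rw [if_neg hC0, if_neg (by rwa [Finset.card_eq_zero]), zero_add,
          Ww_card k s hk hs _ C rfl, ih _ (hS ▸ hlt) (S \ C) rfl, Finset.card_sdiff_of_subset hC, hS]
    rw [Finset.sum_congr rfl h2, Finset.sum_add_distrib, Finset.sum_ite_eq' S.powerset ∅,
      if_pos (Finset.empty_mem_powerset S)] at h1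
    exact eq_neg_of_add_eq_zero_left h1
  rw [NMpoly_eq, key S hS, key (Finset.Icc 1 n) (by simp),
    sum_card_aux S (fun m => if m = 0 then 0 else vz k s m * NMpoly Γ (n - m)),
    sum_card_aux _ (fun m => if m = 0 then 0 else vz k s m * NMpoly Γ (n - m)), hS]
  simp

theorem vz_rec (k s : ℕ) (hk : 2 ≤ k) (hs : k ≤ s) (n : ℕ) (hn : 1 ≤ n) :
    ∑ m ∈ Finset.range (n + 1), (n.choose m : ℚ) • (vz k s (m : ℤ) *
      NMpoly (GammaK k k ∪ {List.range' 1 (s + 1)}) (n - m)) = 0 := by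
  set Γ := GammaK k k ∪ {List.range' 1 (s + 1)} with hΓ
  have h1 := inv_main k s (Nw Γ) (Bw Γ) (by simp [Nw]) (Nw_eq Γ)
    (fun A T hA hd => Bw_eq k s hk hs A T hA hd) (Finset.range n)
    (Finset.card_pos.mp (by rw [Finset.card_range]; omega))
  have h2 : ∀ C ∈ (Finset.range n).powerset, Ww k s C * Nw Γ (Finset.range n \ C) =
      vz k s C.card * NMpoly Γ (n - C.card) := by
    intro C hC
    rw [Finset.mem_powerset] at hC
    rw [Ww_card k s hk hs _ C rfl, Nw_card k s hk hs _ _ rfl, Finset.card_sdiff_of_subset hC,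
      Finset.card_range]
  rw [Finset.sum_congr rfl h2, sum_card_aux _ (fun m => vz k s m * NMpoly Γ (n - m)),
    Finset.card_range] at h1
  rw [← h1]
  apply Finset.sum_congr rfl
  intro m _
  rw [Nat.cast_smul_eq_nsmul]

theorem U_eq_vz (k s : ℕ) (hk : 2 ≤ k) (hs : k ≤ s) (U : ℤ → Polynomial ℚ) (hU0 : U 0 = 1)
    (hUrec : ∀ n : ℕ, 1 ≤ n →
      ∑ m ∈ Finset.range (n + 1), (n.choose m : ℚ) • (U (m : ℤ) *
        NMpoly (GammaK k k ∪ {List.range' 1 (s + 1)}) (n - m)) = 0) :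
    ∀ n : ℕ, U n = vz k s n := by
  intro n
  induction n using Nat.strong_induction_on with
  | _ n ih =>
  rcases Nat.eq_zero_or_pos n with h | h
  · subst h
    rw [vz_nat]
    simp [Ww, hU0]
  · have h1 := hUrec n h
    have h2 := vz_rec k s hk hs n h
    rw [Finset.sum_range_succ] at h1 h2
    rw [Finset.sum_congr rfl (fun m hm => by rw [ih m (Finset.mem_range.mp hm)])] at h1
    have h3 := add_left_cancel (h1.trans h2.symm)
    simpa [NMpoly] using h3

theorem stmt5 (k1 s : ℕ) (hk1 : 2 ≤ k1) (hs : k1 ≤ s)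
    (Γ : Set (List ℕ)) (hΓ : Γ = GammaK k1 k1 ∪ {List.range' 1 (s + 1)})
    (U : ℤ → Polynomial ℚ)
    (hUneg : ∀ m : ℤ, m < 0 → U m = 0)
    (hU0 : U 0 = 1)
    (hUrec : ∀ n : ℕ, 1 ≤ n →
      ∑ k ∈ Finset.range (n + 1), (n.choose k : ℚ) • (U (k : ℤ) * NMpoly Γ (n - k)) = 0) :
    U 1 = -X ∧ ∀ n : ℕ, 2 ≤ n →
      U (n : ℤ) = -X * (∑ r ∈ Finset.Icc 1 (k1 - 1), U ((n : ℤ) - r)) -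
        X * ∑ p ∈ Finset.range (s - k1 + 1),
          ((1 + ((n - p - 2).choose (k1 - 1) : Polynomial ℚ)) * U ((n : ℤ) - p - k1) +
            X * ((n - p - 2).choose (k1 - 1) : Polynomial ℚ) *
              ∑ a ∈ Finset.Icc 1 (k1 - 1), U ((n : ℤ) - p - k1 - a)) := by
  subst hΓ
  have hU := U_eq_vz k1 s hk1 hs U hU0 hUrec
  have hUz : ∀ m : ℤ, U m = vz k1 s m := by
    intro m
    rcases lt_or_ge m 0 with h | h
    · rw [hUneg m h, vz_neg k1 s m h]
    · obtain ⟨n, rfl⟩ := Int.eq_ofNat_of_zero_le h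
      exact hU n
  have key : ∀ n : ℕ, 1 ≤ n →
      U (n : ℤ) = -X * (∑ r ∈ Finset.Icc 1 (k1 - 1), U ((n : ℤ) - r)) -
        X * ∑ p ∈ Finset.range (s - k1 + 1),
          ((1 + ((n - p - 2).choose (k1 - 1) : Polynomial ℚ)) * U ((n : ℤ) - p - k1) +
            X * ((n - p - 2).choose (k1 - 1) : Polynomial ℚ) *
              ∑ a ∈ Finset.Icc 1 (k1 - 1), U ((n : ℤ) - p - k1 - a)) := by
    intro n hn
    have h1 := Ww_formula k1 s hk1 hs U hUneg (Finset.range n)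
      (Finset.card_pos.mp (by rw [Finset.card_range]; omega))
      (fun A _ => by rw [Ww_card k1 s hk1 hs _ A rfl, hUz])
    rw [Finset.card_range] at h1
    rw [hUz (n : ℤ), vz_nat]
    exact h1
  refine ⟨?_, fun n hn => key n (by omega)⟩
  have h1 := hUrec 1 le_rfl
  have h2 : NMpoly (GammaK k1 k1 ∪ {List.range' 1 (s + 1)}) 1 = X := by
    rw [← Nw_card k1 s hk1 hs 1 {1} (by simp), Nw_eq _ _ (by simp)]
    have hp : ({1} : Finset ℕ).powerset = {∅, {1}} := by decide
    rw [hp, Finset.sum_pair (by decide), if_neg (by simp), if_pos (by simp), zero_add,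
      Bw_eq k1 s hk1 hs _ _ (by simp) (by simp), if_pos (by simp; omega)]
    simp
  rw [Finset.sum_range_succ, Finset.sum_range_one] at h1
  have h3 : NMpoly (GammaK k1 k1 ∪ {List.range' 1 (s + 1)}) 0 = 1 := by simp [NMpoly]
  simp only [Nat.cast_zero, Nat.cast_one, Nat.sub_zero, Nat.sub_self, h2, h3, hU0,
    Nat.choose_zero_right, Nat.choose_self, one_smul, one_mul, mul_one] at h1
  exact eq_neg_of_add_eq_zero_right h1
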